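/- Let k be a field, q ∈ k^* admitting a square root in k, and a ∈ k[h^{±1}] a nonzero element that is not a monomial. In A = k[h^{±1}](σ_inv, a) with σ_inv(h) = q h^{-1}, the multiplicative set Σ generated by x (respectively, the multiplicative set Σ' generated by y) consists of regular elements and satisfies the Ore condition, and the Ore localization of A at Σ (respectively at Σ') is isomorphic as a k-algebra to k[h^{±1}](σ'_inv, 1) with σ'_inv(h) = h^{-1}. -/

import Mathlib

open LaurentPolynomial

/-- The defining relations of the degree-one generalized Weyl algebra `k[h^{±1}](σ, a)`:
the generators `Sum.inl p` (for `p` a Laurent polynomial) give a copy of `k[h^{±1}]`,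
and the generators `x = Sum.inr 0` and `y = Sum.inr 1` satisfy
`y x = a`, `x y = σ a`, `x r = σ(r) x` and `y r = σ⁻¹(r) y` for all `r ∈ k[h^{±1}]`. -/
inductive GWARel (k : Type*) [CommRing k] (σ : LaurentPolynomial k ≃ₐ[k] LaurentPolynomial k)
    (a : LaurentPolynomial k) :
    FreeAlgebra k (LaurentPolynomial k ⊕ Fin 2) →
      FreeAlgebra k (LaurentPolynomial k ⊕ Fin 2) → Prop
  | add (r s : LaurentPolynomial k) :
      GWARel k σ a (FreeAlgebra.ι k (Sum.inl (r + s)))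
        (FreeAlgebra.ι k (Sum.inl r) + FreeAlgebra.ι k (Sum.inl s))
  | mul (r s : LaurentPolynomial k) :
      GWARel k σ a (FreeAlgebra.ι k (Sum.inl (r * s)))
        (FreeAlgebra.ι k (Sum.inl r) * FreeAlgebra.ι k (Sum.inl s))
  | smul (c : k) (r : LaurentPolynomial k) :
      GWARel k σ a (FreeAlgebra.ι k (Sum.inl (c • r))) (c • FreeAlgebra.ι k (Sum.inl r))
  | one : GWARel k σ a (FreeAlgebra.ι k (Sum.inl 1)) 1
  | xr (r : LaurentPolynomial k) :
      GWARel k σ a (FreeAlgebra.ι k (Sum.inr 0) * FreeAlgebra.ι k (Sum.inl r))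
        (FreeAlgebra.ι k (Sum.inl (σ r)) * FreeAlgebra.ι k (Sum.inr 0))
  | yr (r : LaurentPolynomial k) :
      GWARel k σ a (FreeAlgebra.ι k (Sum.inr 1) * FreeAlgebra.ι k (Sum.inl r))
        (FreeAlgebra.ι k (Sum.inl (σ.symm r)) * FreeAlgebra.ι k (Sum.inr 1))
  | yx : GWARel k σ a (FreeAlgebra.ι k (Sum.inr 1) * FreeAlgebra.ι k (Sum.inr 0))
        (FreeAlgebra.ι k (Sum.inl a))
  | xy : GWARel k σ a (FreeAlgebra.ι k (Sum.inr 0) * FreeAlgebra.ι k (Sum.inr 1))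
        (FreeAlgebra.ι k (Sum.inl (σ a)))

/-- The degree-one generalized Weyl algebra `k[h^{±1}](σ, a)`, presented as the quotient of
the free algebra on `k[h^{±1}] ⊕ {x, y}` by the generalized Weyl relations. -/
abbrev GWA (k : Type*) [CommRing k] (σ : LaurentPolynomial k ≃ₐ[k] LaurentPolynomial k)
    (a : LaurentPolynomial k) :=
  RingQuot (GWARel k σ a)

namespace GWA

variable {k : Type*} [CommRing k] (σ : LaurentPolynomial k ≃ₐ[k] LaurentPolynomial k)
  (a : LaurentPolynomial k)

/-- The copy of the Laurent polynomial `p` inside the generalized Weyl algebra. -/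
noncomputable def r (p : LaurentPolynomial k) : GWA k σ a :=
  RingQuot.mkAlgHom k (GWARel k σ a) (FreeAlgebra.ι k (Sum.inl p))

/-- The element `h` of the generalized Weyl algebra. -/
noncomputable def H : GWA k σ a := r σ a (T 1)

/-- The element `h⁻¹` of the generalized Weyl algebra. -/
noncomputable def Hinv : GWA k σ a := r σ a (T (-1))

/-- The generator `x` of the generalized Weyl algebra. -/
noncomputable def x : GWA k σ a :=
  RingQuot.mkAlgHom k (GWARel k σ a) (FreeAlgebra.ι k (Sum.inr 0))

/-- The generator `y` of the generalized Weyl algebra. -/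
noncomputable def y : GWA k σ a :=
  RingQuot.mkAlgHom k (GWARel k σ a) (FreeAlgebra.ι k (Sum.inr 1))

end GWA

/-- An element `a ∈ k[h^{±1}]` is a monomial if `a = c·hⁱ` for some `c ∈ k`, `i ∈ ℤ`. -/
def LaurentPolynomial.IsMonomial {k : Type*} [CommRing k] (a : LaurentPolynomial k) : Prop :=
  ∃ (c : k) (i : ℤ), a = C c * T i

theorem LaurentPolynomial.algHom_ext_T {k B : Type*} [CommRing k] [Ring B] [Algebra k B]
    {f g : LaurentPolynomial k →ₐ[k] B} (h : f (T 1) = g (T 1)) : f = g := by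
  refine AddMonoidAlgebra.algHom_ext' ?_ (by ext)
  exact MonoidHom.ext_mint h

/-- The rescaling endomorphism `h ↦ c h` of `k[h^{±1}]`. -/
noncomputable def LaurentPolynomial.scale {k : Type*} [CommRing k] (c : kˣ) :
    LaurentPolynomial k →ₐ[k] LaurentPolynomial k :=
  { eval₂ (algebraMap k (LaurentPolynomial k))
      (Units.map (C : k →+* LaurentPolynomial k).toMonoidHom c * (isUnit_T 1).unit) with
    commutes' := fun r => by
      change eval₂ _ _ (algebraMap k (LaurentPolynomial k) r) = _
      rw [← C_eq_algebraMap, eval₂_C, C_eq_algebraMap] }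

theorem LaurentPolynomial.scale_T_one {k : Type*} [CommRing k] (c : kˣ) :
    scale c (T 1) = C (c : k) * T 1 := by
  change eval₂ _ _ (T 1) = _
  simp

/-- The rescaling automorphism `h ↦ c h` of `k[h^{±1}]`. -/
noncomputable def LaurentPolynomial.scaleEquiv {k : Type*} [CommRing k] (c : kˣ) :
    LaurentPolynomial k ≃ₐ[k] LaurentPolynomial k :=
  have key (d : kˣ) : (scale d).comp (scale d⁻¹) = AlgHom.id k (LaurentPolynomial k) := by
    refine algHom_ext_T ?_
    rw [AlgHom.comp_apply, scale_T_one, map_mul, scale_T_one, C_eq_algebraMap, AlgHom.commutes,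
      ← C_eq_algebraMap, ← mul_assoc, ← map_mul]
    simp
  AlgEquiv.ofAlgHom (scale c) (scale c⁻¹) (key c) (by simpa using key c⁻¹)

/-- An automorphism of `k[h^{±1}]` sending `h` to `q h⁻¹` is an involution. -/
theorem LaurentPolynomial.involutive_of_apply_T_one {k : Type*} [CommRing k]
    {σ : LaurentPolynomial k ≃ₐ[k] LaurentPolynomial k} {q : k}
    (hσ : σ (T 1) = C q * T (-1)) : Function.Involutive σ := by
  have hC (c : k) : σ (C c) = C c := by rw [C_eq_algebraMap, AlgEquiv.commutes]
  have hinv : C q * T (-1) * σ (T (-1)) = 1 := by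
    rw [← hσ, ← map_mul, ← T_add]
    simp
  have h : (σ : LaurentPolynomial k →ₐ[k] LaurentPolynomial k).comp
      (σ : LaurentPolynomial k →ₐ[k] LaurentPolynomial k) = AlgHom.id k _ := by
    refine algHom_ext_T ?_
    have hT : (T 1 : LaurentPolynomial k) * T (-1) = 1 := by rw [← T_add]; simp
    change σ (σ (T 1)) = T 1
    rw [hσ, map_mul, hC]
    calc C q * σ (T (-1)) = (C q * T (-1) * σ (T (-1))) * T 1 := by
          linear_combination (-(C q * σ (T (-1)))) * hT
      _ = T 1 := by rw [hinv, one_mul]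
  exact fun p => DFunLike.congr_fun h p

/-- Rescaling by a square root `s` of `q` conjugates `h ↦ q h⁻¹` into `h ↦ h⁻¹`. -/
theorem LaurentPolynomial.scaleEquiv_apply_of_sq {k : Type*} [CommRing k]
    {σ σ' : LaurentPolynomial k ≃ₐ[k] LaurentPolynomial k} (s : kˣ)
    (hσ : σ (T 1) = C ((s : k) ^ 2) * T (-1)) (hσ' : σ' (T 1) = T (-1))
    (p : LaurentPolynomial k) : scaleEquiv s (σ p) = σ' (scaleEquiv s p) := by
  have hC (τ : LaurentPolynomial k ≃ₐ[k] LaurentPolynomial k) (c : k) : τ (C c) = C c := by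
    rw [C_eq_algebraMap, AlgEquiv.commutes]
  have h1 : scaleEquiv s (T 1) = C (s : k) * T 1 := scale_T_one s
  have hT : (T 1 : LaurentPolynomial k) * T (-1) = 1 := by rw [← T_add]; simp
  have hinv : C (s : k) * T 1 * scaleEquiv s (T (-1)) = 1 := by
    rw [← h1, ← map_mul, hT, map_one]
  have h : (scaleEquiv s : LaurentPolynomial k →ₐ[k] LaurentPolynomial k).comp
      (σ : LaurentPolynomial k →ₐ[k] LaurentPolynomial k) =
      (σ' : LaurentPolynomial k →ₐ[k] LaurentPolynomial k).comp
        (scaleEquiv s : LaurentPolynomial k →ₐ[k] LaurentPolynomial k) := by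
    refine algHom_ext_T ?_
    change scaleEquiv s (σ (T 1)) = σ' (scaleEquiv s (T 1))
    rw [hσ, h1, map_mul, map_mul, hC, hC, hσ', map_pow]
    linear_combination (C (s : k) * T (-1)) * hinv -
      C (s : k) ^ 2 * scaleEquiv s (T (-1)) * hT
  exact DFunLike.congr_fun h p

namespace GWA

section Basic

variable {k : Type*} [CommRing k] {σ : LaurentPolynomial k ≃ₐ[k] LaurentPolynomial k}
  {a : LaurentPolynomial k}

/-- The inclusion of `k[h^{±1}]` into a generalized Weyl algebra, as an algebra map. -/
noncomputable def rHom (σ : LaurentPolynomial k ≃ₐ[k] LaurentPolynomial k)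
    (a : LaurentPolynomial k) : LaurentPolynomial k →ₐ[k] GWA k σ a :=
  AlgHom.ofLinearMap
    { toFun := r σ a
      map_add' := fun p p' => by
        simpa [r] using RingQuot.mkAlgHom_rel k (GWARel.add (σ := σ) (a := a) p p')
      map_smul' := fun c p => by
        simpa [r] using RingQuot.mkAlgHom_rel k (GWARel.smul (σ := σ) (a := a) c p) }
    (by simpa [r] using RingQuot.mkAlgHom_rel k (GWARel.one (σ := σ) (a := a)))
    (fun p p' => by
      simpa [r] using RingQuot.mkAlgHom_rel k (GWARel.mul (σ := σ) (a := a) p p'))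

theorem x_mul_r (p : LaurentPolynomial k) :
    x σ a * rHom σ a p = rHom σ a (σ p) * x σ a := by
  have h := RingQuot.mkAlgHom_rel k (GWARel.xr (σ := σ) (a := a) p)
  rwa [map_mul, map_mul] at h

theorem y_mul_r (p : LaurentPolynomial k) :
    y σ a * rHom σ a p = rHom σ a (σ.symm p) * y σ a := by
  have h := RingQuot.mkAlgHom_rel k (GWARel.yr (σ := σ) (a := a) p)
  rwa [map_mul, map_mul] at h

theorem y_mul_x : y σ a * x σ a = rHom σ a a := by
  have h := RingQuot.mkAlgHom_rel k (GWARel.yx (σ := σ) (a := a))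
  rwa [map_mul] at h

theorem x_mul_y : x σ a * y σ a = rHom σ a (σ a) := by
  have h := RingQuot.mkAlgHom_rel k (GWARel.xy (σ := σ) (a := a))
  rwa [map_mul] at h

@[elab_as_elim]
theorem induction {P : GWA k σ a → Prop} (hr : ∀ p, P (rHom σ a p)) (hx : P (x σ a))
    (hy : P (y σ a)) (hadd : ∀ z w, P z → P w → P (z + w))
    (hmul : ∀ z w, P z → P w → P (z * w)) (z : GWA k σ a) : P z := by
  obtain ⟨z, rfl⟩ := RingQuot.mkAlgHom_surjective k (GWARel k σ a) z
  induction z using FreeAlgebra.induction with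
  | grade0 c =>
    rw [AlgHom.commutes, ← AlgHom.commutes (rHom σ a)]
    exact hr _
  | grade1 i =>
    rcases i with p | i
    · exact hr p
    · fin_cases i
      · exact hx
      · exact hy
  | mul z w hz hw => rw [map_mul]; exact hmul _ _ hz hw
  | add z w hz hw => rw [map_add]; exact hadd _ _ hz hw

section Lift

variable {B : Type*} [Ring B] [Algebra k B] (φ : LaurentPolynomial k →ₐ[k] B) (X Y : B)
  (hxr : ∀ p, X * φ p = φ (σ p) * X) (hyr : ∀ p, Y * φ p = φ (σ.symm p) * Y)
  (hyx : Y * X = φ a) (hxy : X * Y = φ (σ a))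

/-- The universal property of a generalized Weyl algebra. -/
noncomputable def lift : GWA k σ a →ₐ[k] B :=
  RingQuot.liftAlgHom k ⟨FreeAlgebra.lift k (Sum.elim φ ![X, Y]), fun u v h => by
    induction h <;> simp [hxr, hyr, hyx, hxy]⟩

@[simp]
theorem lift_r (p : LaurentPolynomial k) :
    lift φ X Y hxr hyr hyx hxy (rHom σ a p) = φ p := by
  change lift φ X Y hxr hyr hyx hxy (RingQuot.mkAlgHom k _ _) = _
  simp [lift]

@[simp]
theorem lift_x : lift φ X Y hxr hyr hyx hxy (x σ a) = X := by
  simp [lift, x]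

@[simp]
theorem lift_y : lift φ X Y hxr hyr hyx hxy (y σ a) = Y := by
  simp [lift, y]

end Lift

theorem algHom_ext {B : Type*} [Ring B] [Algebra k B] {f g : GWA k σ a →ₐ[k] B}
    (hr : ∀ p, f (rHom σ a p) = g (rHom σ a p)) (hx : f (x σ a) = g (x σ a))
    (hy : f (y σ a) = g (y σ a)) : f = g := by
  refine AlgHom.ext fun z => ?_
  induction z using GWA.induction with
  | hr p => exact hr p
  | hx => exact hx
  | hy => exact hy
  | hadd z w hz hw => rw [map_add, map_add, hz, hw]
  | hmul z w hz hw => rw [map_mul, map_mul, hz, hw]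

/-- For an involution `σ`, the square of `x` is central. -/
theorem commute_x_sq (hσ : Function.Involutive σ) (z : GWA k σ a) : Commute (x σ a ^ 2) z := by
  induction z using GWA.induction with
  | hr p =>
    rw [commute_iff_eq, sq, mul_assoc, x_mul_r, ← mul_assoc, x_mul_r, hσ, mul_assoc]
  | hx => exact (Commute.refl _).pow_left 2
  | hy =>
    rw [commute_iff_eq, sq, mul_assoc, x_mul_y, x_mul_r, hσ, ← mul_assoc, y_mul_x]
  | hadd z w hz hw => exact hz.add_right hw
  | hmul z w hz hw => exact hz.mul_right hw

/-- For an involution `σ`, exchanging `x` and `y` maps `k[h^{±1}](σ, a)` to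
`k[h^{±1}](σ, σ a)`. -/
noncomputable def swapHom (hσ : Function.Involutive σ) {b : LaurentPolynomial k} (hb : σ a = b) :
    GWA k σ a →ₐ[k] GWA k σ b :=
  have hsymm (p : LaurentPolynomial k) : σ.symm p = σ p := by rw [AlgEquiv.symm_apply_eq, hσ]
  lift (rHom σ b) (y σ b) (x σ b) (fun p => by rw [y_mul_r, hsymm])
    (fun p => by rw [x_mul_r, hsymm]) (by rw [x_mul_y, ← hb, hσ]) (by rw [y_mul_x, hb])

theorem swapHom_comp_swapHom (hσ : Function.Involutive σ) {b : LaurentPolynomial k}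
    (hb : σ a = b) (ha : σ b = a) :
    (swapHom hσ hb).comp (swapHom hσ ha) = AlgHom.id k _ := by
  apply algHom_ext <;> simp [swapHom]

/-- For an involution `σ`, exchanging `x` and `y` identifies `k[h^{±1}](σ, a)` with
`k[h^{±1}](σ, σ a)`. -/
noncomputable def swap (hσ : Function.Involutive σ) (a : LaurentPolynomial k) :
    GWA k σ a ≃ₐ[k] GWA k σ (σ a) :=
  AlgEquiv.ofAlgHom (swapHom hσ rfl) (swapHom hσ (hσ a)) (swapHom_comp_swapHom hσ _ _)
    (swapHom_comp_swapHom hσ _ _)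

theorem swap_y (hσ : Function.Involutive σ) : swap hσ a (y σ a) = x σ (σ a) := by
  change swapHom hσ rfl (y σ a) = _
  simp [swapHom]

/-- The standard monomials of a generalized Weyl algebra: `xⁿ` in degree `n ≥ 0` and `yⁿ` in
degree `-n ≤ 0`. -/
noncomputable def mon (σ : LaurentPolynomial k ≃ₐ[k] LaurentPolynomial k)
    (a : LaurentPolynomial k) : ℤ → GWA k σ a
  | Int.ofNat n => x σ a ^ n
  | Int.negSucc n => y σ a ^ (n + 1)

theorem exists_mon_eq_y_pow (n : ℕ) : ∃ i, mon σ a i = y σ a ^ n := by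
  cases n with
  | zero => exact ⟨0, by simp [mon]⟩
  | succ n => exact ⟨Int.negSucc n, rfl⟩

/-- The map sending a family of Laurent polynomials to the corresponding combination of standard
monomials. -/
noncomputable def combination (σ : LaurentPolynomial k ≃ₐ[k] LaurentPolynomial k)
    (a : LaurentPolynomial k) : (ℤ →₀ LaurentPolynomial k) →ₗ[k] GWA k σ a :=
  Finsupp.lsum k fun i => (LinearMap.mulRight k (mon σ a i)).comp (rHom σ a).toLinearMap

theorem combination_single (i : ℤ) (p : LaurentPolynomial k) :
    combination σ a (Finsupp.single i p) = rHom σ a p * mon σ a i := by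
  simp [combination]

theorem combination_surjective : Function.Surjective (combination σ a) := by
  have mul_mem {z : GWA k σ a}
      (h : ∀ i p, z * (rHom σ a p * mon σ a i) ∈ (combination σ a).range) :
      ∀ w ∈ (combination σ a).range, z * w ∈ (combination σ a).range := by
    rintro _ ⟨w, rfl⟩
    induction w using Finsupp.induction_linear with
    | zero => simp
    | add u v hu hv => rw [map_add, mul_add]; exact add_mem hu hv
    | single i p => rw [combination_single]; exact h i p
  have mem (i : ℤ) (p : LaurentPolynomial k) :
      rHom σ a p * mon σ a i ∈ (combination σ a).range :=
    ⟨Finsupp.single i p, combination_single i p⟩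
  have mem_y (n : ℕ) (p : LaurentPolynomial k) :
      rHom σ a p * y σ a ^ n ∈ (combination σ a).range := by
    obtain ⟨i, hi⟩ := exists_mon_eq_y_pow (σ := σ) (a := a) n
    rw [← hi]
    exact mem i p
  have mem_x (n : ℕ) (p : LaurentPolynomial k) :
      rHom σ a p * x σ a ^ n ∈ (combination σ a).range := mem (Int.ofNat n) p
  intro z
  suffices h : ∀ w ∈ (combination σ a).range, z * w ∈ (combination σ a).range by
    simpa using h 1 (by simpa using mem_x 0 1)
  induction z using GWA.induction with
  | hr p =>
    refine mul_mem fun i p' => ?_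
    rw [← mul_assoc, ← map_mul]
    exact mem i _
  | hx =>
    refine mul_mem fun i p => ?_
    rw [← mul_assoc, x_mul_r, mul_assoc]
    rcases i with n | n
    · rw [mon, ← pow_succ']
      exact mem_x _ _
    · rw [mon, pow_succ', ← mul_assoc (x σ a), x_mul_y, ← mul_assoc, ← map_mul]
      exact mem_y _ _
  | hy =>
    refine mul_mem fun i p => ?_
    rw [← mul_assoc, y_mul_r, mul_assoc]
    rcases i with n | n
    · rcases n with _ | n
      · simpa [mon] using mem_y 1 (σ.symm p)
      · change _ * (_ * x σ a ^ (n + 1)) ∈ _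
        rw [pow_succ', ← mul_assoc (y σ a), y_mul_x, ← mul_assoc, ← map_mul]
        exact mem_x _ _
    · rw [mon, ← pow_succ']
      exact mem_y _ _
  | hadd z w hz hw => intro v hv; rw [add_mul]; exact add_mem (hz v hv) (hw v hv)
  | hmul z w hz hw => intro v hv; rw [mul_assoc]; exact hz _ (hw v hv)

/-- The representation of `k[h^{±1}](σ, 1)` on families of Laurent polynomials in which `x` acts
by shifting and applying `σ`. -/
noncomputable def shiftRep (σ : LaurentPolynomial k ≃ₐ[k] LaurentPolynomial k) :
    GWA k σ 1 →ₐ[k] Module.End k (ℤ → LaurentPolynomial k) :=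
  lift (Algebra.lsmul k k (ℤ → LaurentPolynomial k))
    (LinearMap.pi fun i => σ.toLinearMap.comp (LinearMap.proj (i - 1)))
    (LinearMap.pi fun i => σ.symm.toLinearMap.comp (LinearMap.proj (i + 1)))
    (fun p => by ext; simp) (fun p => by ext; simp) (by ext; simp) (by ext; simp)

/-- The coefficients of an element of `k[h^{±1}](σ, 1)` in the basis of powers of `x`. -/
noncomputable def coeff (σ : LaurentPolynomial k ≃ₐ[k] LaurentPolynomial k)
    (b : GWA k σ 1) : ℤ → LaurentPolynomial k :=
  shiftRep σ b (Pi.single 0 1)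

theorem coeff_r_mul (p : LaurentPolynomial k) (b : GWA k σ 1) (i : ℤ) :
    coeff σ (rHom σ 1 p * b) i = p * coeff σ b i := by
  simp [coeff, shiftRep]

theorem coeff_x_mul (b : GWA k σ 1) (i : ℤ) :
    coeff σ (x σ 1 * b) i = σ (coeff σ b (i - 1)) := by
  simp [coeff, shiftRep]

theorem coeff_y_mul (b : GWA k σ 1) (i : ℤ) :
    coeff σ (y σ 1 * b) i = σ.symm (coeff σ b (i + 1)) := by
  simp [coeff, shiftRep]

/-- An isomorphism `φ` of `k[h^{±1}]` intertwining `σ` and `σ'` induces a map from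
`k[h^{±1}](σ, a)` to `k[h^{±1}](σ', 1)` sending `x` to `x`. -/
noncomputable def toLocalization (φ σ' : LaurentPolynomial k ≃ₐ[k] LaurentPolynomial k)
    (hφ : ∀ p, φ (σ p) = σ' (φ p)) (a : LaurentPolynomial k) : GWA k σ a →ₐ[k] GWA k σ' 1 :=
  lift ((rHom σ' 1).comp (φ : LaurentPolynomial k →ₐ[k] LaurentPolynomial k)) (x σ' 1)
    (rHom σ' 1 (φ a) * y σ' 1)
    (fun p => by simp [x_mul_r, hφ])
    (fun p => by
      have h : σ'.symm (φ p) = φ (σ.symm p) := by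
        rw [AlgEquiv.symm_apply_eq, ← hφ, AlgEquiv.apply_symm_apply]
      change rHom σ' 1 (φ a) * y σ' 1 * rHom σ' 1 (φ p) =
        rHom σ' 1 (φ (σ.symm p)) * (rHom σ' 1 (φ a) * y σ' 1)
      rw [mul_assoc, y_mul_r, h, ← mul_assoc, ← mul_assoc, ← map_mul (rHom σ' 1),
        ← map_mul (rHom σ' 1), mul_comm (φ a)])
    (by simp [mul_assoc, y_mul_x])
    (by simp [← mul_assoc, x_mul_r, hφ]; simp [mul_assoc, x_mul_y])

variable {φ σ' : LaurentPolynomial k ≃ₐ[k] LaurentPolynomial k}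
  (hφ : ∀ p, φ (σ p) = σ' (φ p))

@[simp]
theorem toLocalization_r (p : LaurentPolynomial k) :
    toLocalization φ σ' hφ a (rHom σ a p) = rHom σ' 1 (φ p) :=
  lift_r ..

@[simp]
theorem toLocalization_x : toLocalization φ σ' hφ a (x σ a) = x σ' 1 :=
  lift_x ..

@[simp]
theorem toLocalization_y :
    toLocalization φ σ' hφ a (y σ a) = rHom σ' 1 (φ a) * y σ' 1 :=
  lift_y ..

end Basic

section Localization

/-- A faithful algebra map inverting an element whose square is central, and with every element
of the target a fraction, exhibits the target as the Ore localization at that element. -/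
theorem isOreLocalization_of_sq_central {k A B : Type*} [CommRing k] [Ring A] [Algebra k A]
    [Ring B] [Algebra k B] {u : A} (hu : ∀ z, Commute (u ^ 2) z) (f : A →ₐ[k] B)
    (hf : Function.Injective f) (hfu : IsUnit (f u))
    (hfrac : ∀ b, ∃ (z : A) (n : ℕ), b * f (u ^ n) = f z) :
    (∀ t ∈ Submonoid.powers u, IsRegular t) ∧
      (∀ (r : A), ∀ t ∈ Submonoid.powers u,
        ∃ (r' : A), ∃ t' ∈ Submonoid.powers u, r * t' = t * r') ∧
      ∃ f : A →ₐ[k] B, Function.Injective f ∧ (∀ t ∈ Submonoid.powers u, IsUnit (f t)) ∧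
        ∀ b : B, ∃ (r : A), ∃ t ∈ Submonoid.powers u, b * f t = f r := by
  have hunit : ∀ t ∈ Submonoid.powers u, IsUnit (f t) := by
    rintro _ ⟨n, rfl⟩
    simpa using hfu.pow n
  refine ⟨fun t ht => ⟨fun v w h => hf ?_, fun v w h => hf ?_⟩, ?_, f, hf, hunit, fun b => ?_⟩
  · refine (hunit t ht).mul_left_cancel ?_
    simpa using congrArg f h
  · refine (hunit t ht).mul_right_cancel ?_
    simpa using congrArg f h
  · rintro z _ ⟨n, rfl⟩
    refine ⟨u ^ n * z, u ^ (2 * n), ⟨_, rfl⟩, ?_⟩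
    rw [pow_mul, ← ((hu z).pow_left n).eq, ← pow_mul, two_mul, pow_add, mul_assoc]
  · obtain ⟨z, n, h⟩ := hfrac b
    exact ⟨z, u ^ n, ⟨n, rfl⟩, h⟩

variable {k : Type*} [Field k] {σ σ' φ : LaurentPolynomial k ≃ₐ[k] LaurentPolynomial k}
  (hφ : ∀ p, φ (σ p) = σ' (φ p)) {a : LaurentPolynomial k}

theorem isUnit_x : IsUnit (x σ 1) :=
  ⟨⟨x σ 1, y σ 1, by simp [x_mul_y], by simp [y_mul_x]⟩, rfl⟩

theorem exists_coeff_toLocalization_mon (ha : a ≠ 0) (i : ℤ) :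
    ∃ c ≠ 0, coeff σ' (toLocalization φ σ' hφ a (mon σ a i)) = Pi.single i c := by
  have h1 : coeff σ' (1 : GWA k σ' 1) = Pi.single 0 1 := by simp [coeff]
  rcases i with n | n
  · refine ⟨1, one_ne_zero, ?_⟩
    simp only [mon, map_pow, toLocalization_x]
    induction n with
    | zero => simpa using h1
    | succ n ih =>
      ext1 i
      rw [pow_succ', coeff_x_mul, ih]
      by_cases h : i = n + 1
      · subst h; simp
      · have h' : i - 1 ≠ n := by lia
        simp [h, h']
  · suffices H : ∀ n : ℕ, ∃ c ≠ 0,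
        coeff σ' (toLocalization φ σ' hφ a (y σ a ^ n)) = Pi.single (-(n : ℤ)) c by
      exact H (n + 1)
    intro n
    simp only [map_pow, toLocalization_y]
    induction n with
    | zero => exact ⟨1, one_ne_zero, by simpa using h1⟩
    | succ n ih =>
      obtain ⟨c, hc, ih⟩ := ih
      refine ⟨φ a * σ'.symm c, mul_ne_zero (by simpa using ha) (by simpa using hc), ?_⟩
      ext1 i
      rw [pow_succ', mul_assoc, coeff_r_mul, coeff_y_mul, ih]
      by_cases h : i = -((n + 1 : ℕ) : ℤ)
      · subst h; simp
      · have h' : i + 1 ≠ -n := by lia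
        rw [Pi.single_eq_of_ne h, Pi.single_eq_of_ne h', map_zero, mul_zero]

theorem toLocalization_injective (ha : a ≠ 0) :
    Function.Injective (toLocalization φ σ' hφ a) := by
  choose c hc hcoeff using exists_coeff_toLocalization_mon hφ (a := a) ha
  have key (w : ℤ →₀ LaurentPolynomial k) (i : ℤ) :
      coeff σ' (toLocalization φ σ' hφ a (combination σ a w)) i = φ (w i) * c i := by
    induction w using Finsupp.induction_linear with
    | zero => simp [coeff]
    | add u v hu hv =>
      rw [Finsupp.add_apply, map_add φ, add_mul, ← hu, ← hv]
      simp [coeff]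
    | single j p =>
      rw [combination_single, map_mul, toLocalization_r, coeff_r_mul, hcoeff]
      by_cases h : i = j
      · subst h; simp
      · simp [Pi.single_eq_of_ne h, Finsupp.single_eq_of_ne h]
  rw [injective_iff_map_eq_zero]
  intro z hz
  obtain ⟨w, rfl⟩ := combination_surjective z
  suffices w = 0 by rw [this, map_zero]
  ext1 i
  have h := key w i
  rw [hz] at h
  have h0 : φ (w i) * c i = 0 := by rw [← h]; simp [coeff]
  simpa [hc i] using h0

theorem toLocalization_fraction (hσ' : Function.Involutive σ') (b : GWA k σ' 1) :
    ∃ (z : GWA k σ a) (n : ℕ), b * toLocalization φ σ' hφ a (x σ a ^ n) =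
      toLocalization φ σ' hφ a z := by
  suffices h : ∃ (n : ℕ) (z : GWA k σ a), b * (x σ' 1 ^ 2) ^ n = toLocalization φ σ' hφ a z by
    obtain ⟨n, z, h⟩ := h
    refine ⟨z, 2 * n, ?_⟩
    rw [← h, map_pow, ← pow_mul]
    simp
  have hcomm (n : ℕ) (b : GWA k σ' 1) : Commute ((x σ' 1 ^ 2) ^ n) b :=
    (commute_x_sq hσ' b).pow_left n
  have hx := toLocalization_x hφ (a := a)
  induction b using GWA.induction with
  | hr p => exact ⟨0, rHom σ a (φ.symm p), by simp⟩
  | hx => exact ⟨0, x σ a, by simp [hx]⟩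
  | hy => exact ⟨1, x σ a, by rw [hx, pow_one, sq, ← mul_assoc, y_mul_x, map_one, one_mul]⟩
  | hadd b b' hb hb' =>
    obtain ⟨n, z, hz⟩ := hb
    obtain ⟨n', z', hz'⟩ := hb'
    refine ⟨n + n', z * (x σ a ^ 2) ^ n' + z' * (x σ a ^ 2) ^ n, ?_⟩
    simp only [map_add, map_mul, map_pow, hx]
    rw [← hz, ← hz', add_mul, mul_assoc, mul_assoc, ← pow_add, ← pow_add, add_comm n' n]
  | hmul b b' hb hb' =>
    obtain ⟨n, z, hz⟩ := hb
    obtain ⟨n', z', hz'⟩ := hb'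
    refine ⟨n + n', z * z', ?_⟩
    rw [map_mul, ← hz, ← hz', pow_add, mul_assoc b, ← mul_assoc b', ← (hcomm n b').eq,
      mul_assoc _ b', ← mul_assoc b]

end Localization

end GWA

/-- For `q ∈ k^*` with a square root in `k` and `a ≠ 0` not a monomial, in
`A = k[h^{±1}](σ_inv, a)` with `σ_inv(h) = q h⁻¹` the multiplicative sets `Σ` generated by `x`
and `Σ'` generated by `y` consist of regular elements and satisfy the Ore condition, and both
Ore localizations are isomorphic to `k[h^{±1}](σ'_inv, 1)` with `σ'_inv(h) = h⁻¹`: in each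
case there is an injective `k`-algebra map into `k[h^{±1}](σ'_inv, 1)` inverting the
multiplicative set, whose image gives every element as a right fraction. -/
theorem involution_gwa_localizations (k : Type*) [Field k] (q : k) (hq0 : q ≠ 0)
    (s : k) (hs : s ^ 2 = q)
    (σ : LaurentPolynomial k ≃ₐ[k] LaurentPolynomial k) (hσ : σ (T 1) = C q * T (-1))
    (a : LaurentPolynomial k) (ha0 : a ≠ 0) (ha : ¬ a.IsMonomial)
    (σ' : LaurentPolynomial k ≃ₐ[k] LaurentPolynomial k) (hσ' : σ' (T 1) = T (-1)) :
    ((∀ t ∈ Submonoid.powers (GWA.x σ a), IsRegular t) ∧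
        (∀ (r : GWA k σ a), ∀ t ∈ Submonoid.powers (GWA.x σ a),
          ∃ (r' : GWA k σ a), ∃ t' ∈ Submonoid.powers (GWA.x σ a), r * t' = t * r') ∧
        ∃ f : GWA k σ a →ₐ[k] GWA k σ' 1,
          Function.Injective f ∧
            (∀ t ∈ Submonoid.powers (GWA.x σ a), IsUnit (f t)) ∧
            ∀ b : GWA k σ' 1,
              ∃ (r : GWA k σ a), ∃ t ∈ Submonoid.powers (GWA.x σ a), b * f t = f r) ∧
      (∀ t ∈ Submonoid.powers (GWA.y σ a), IsRegular t) ∧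
        (∀ (r : GWA k σ a), ∀ t ∈ Submonoid.powers (GWA.y σ a),
          ∃ (r' : GWA k σ a), ∃ t' ∈ Submonoid.powers (GWA.y σ a), r * t' = t * r') ∧
        ∃ f : GWA k σ a →ₐ[k] GWA k σ' 1,
          Function.Injective f ∧
            (∀ t ∈ Submonoid.powers (GWA.y σ a), IsUnit (f t)) ∧
            ∀ b : GWA k σ' 1,
              ∃ (r : GWA k σ a), ∃ t ∈ Submonoid.powers (GWA.y σ a), b * f t = f r := by
  have hs0 : s ≠ 0 := by
    rintro rfl
    exact hq0 (by simpa using hs.symm)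
  have hinv : Function.Involutive σ := involutive_of_apply_T_one hσ
  have hinv' : Function.Involutive σ' :=
    involutive_of_apply_T_one (q := 1) (by rw [hσ', map_one, one_mul])
  have hφ : ∀ p, scaleEquiv (Units.mk0 s hs0) (σ p) = σ' (scaleEquiv (Units.mk0 s hs0) p) :=
    scaleEquiv_apply_of_sq _ (by rw [Units.val_mk0, hs, hσ]) hσ'
  have hunit (b : LaurentPolynomial k) :
      IsUnit (GWA.toLocalization _ σ' hφ b (GWA.x σ b)) := by
    simpa using GWA.isUnit_x
  refine ⟨GWA.isOreLocalization_of_sq_central (GWA.commute_x_sq hinv)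
    (GWA.toLocalization _ σ' hφ a) (GWA.toLocalization_injective hφ ha0) (hunit a)
    (GWA.toLocalization_fraction hφ hinv'), ?_⟩
  refine GWA.isOreLocalization_of_sq_central (fun z => ?_)
    ((GWA.toLocalization _ σ' hφ (σ a)).comp (GWA.swap hinv a : GWA k σ a →ₐ[k] GWA k σ (σ a)))
    ((GWA.toLocalization_injective hφ (by simpa using ha0)).comp (GWA.swap hinv a).injective)
    ?_ fun b => ?_
  · apply (GWA.swap hinv a).injective
    simpa [GWA.swap_y] using (GWA.commute_x_sq hinv (GWA.swap hinv a z)).eq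
  · simpa [GWA.swap_y] using hunit (σ a)
  · obtain ⟨z, n, h⟩ := GWA.toLocalization_fraction hφ hinv' (a := σ a) b
    exact ⟨(GWA.swap hinv a).symm z, n, by simpa [GWA.swap_y] using h⟩
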